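/- For all nonnegative integers a and b, the number of partitions λ with distinct parts such that ℓ(λ) ≡ 0 or 3 (mod 4), λ_1 = a, and λ_1 + λ_5 + λ_9 + ⋯ = b equals [a = 0 and b = 0] + ∑_{n≥1} T_n, where T_n is the number of quadruples (α¹, α², α³, α⁴) of partitions, each having every part of size at most n, with ℓ(α¹)+ℓ(α²)+ℓ(α³)+ℓ(α⁴) = a − (4n−1) and |α¹|+|α²|+|α³|+|α⁴| = b − (2n+1 choose 2) (T_n = 0 when either quantity is negative; only finitely many T_n are nonzero). (This is the coefficient-wise form of the identity ∑ z^{λ_1} q^{λ_1+λ_5+λ_9+⋯} = 1 + ∑_{n≥1} q^{C(2n+1,2)} z^{4n−1}/(qz;q)_n⁴, summed over distinct-part λ with ℓ(λ) ≡ 0 or 3 mod 4.) -/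

import Mathlib

/-- A partition: a weakly decreasing sequence of naturals with finite support.
`p.parts i` is the `(i+1)`-st part, i.e. parts are 0-indexed (`λ_1 = p.parts 0`). -/
structure Ptn where
  parts : ℕ → ℕ
  antitone' : ∀ ⦃i j : ℕ⦄, i ≤ j → parts j ≤ parts i
  finite_support' : (Function.support parts).Finite

namespace Ptn

/-- The size `|λ|` of a partition: the sum of all its parts. -/
noncomputable def size (p : Ptn) : ℕ := ∑ᶠ i, p.parts i

/-- The number of (nonzero) parts `ℓ(λ)`. -/
noncomputable def length (p : Ptn) : ℕ := (Function.support p.parts).ncard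

/-- A partition has distinct parts if no nonzero value is repeated. -/
def Distinct (p : Ptn) : Prop := ∀ i : ℕ, p.parts (i + 1) ≠ 0 → p.parts (i + 1) < p.parts i

/-- A partition has odd parts if every part is odd. -/
def OddParts (p : Ptn) : Prop := ∀ i : ℕ, p.parts i ≠ 0 → Odd (p.parts i)

end Ptn

/-- `T n a b`: the number of quadruples `(α¹, α², α³, α⁴)` of partitions, each with
every part of size at most `n`, with total length `a - (4n - 1)` and total size
`b - (2n+1 choose 2)` (zero if either of these quantities is negative). -/
noncomputable def T (n a b : ℕ) : ℕ :=
  {q : Ptn × Ptn × Ptn × Ptn |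
      (∀ i, q.1.parts i ≤ n) ∧ (∀ i, q.2.1.parts i ≤ n) ∧
      (∀ i, q.2.2.1.parts i ≤ n) ∧ (∀ i, q.2.2.2.parts i ≤ n) ∧
      ((q.1.length : ℤ) + q.2.1.length + q.2.2.1.length + q.2.2.2.length
        = (a : ℤ) - (4 * (n : ℤ) - 1)) ∧
      ((q.1.size : ℤ) + q.2.1.size + q.2.2.1.size + q.2.2.2.size
        = (b : ℤ) - (n : ℤ) * (2 * (n : ℤ) + 1))}.ncard

namespace Ptn

@[ext]
theorem ext {p q : Ptn} (h : ∀ i, p.parts i = q.parts i) : p = q := by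
  cases p; cases q
  congr
  exact funext h

theorem exists_parts_eq_zero (p : Ptn) : ∃ N, p.parts N = 0 := by
  obtain ⟨N, hN⟩ := p.finite_support'.exists_notMem
  exact ⟨N, by simpa using hN⟩

theorem parts_eq_zero_of_le (p : Ptn) {i j : ℕ} (hij : i ≤ j) (h : p.parts i = 0) :
    p.parts j = 0 :=
  Nat.le_zero.mp (h ▸ p.antitone' hij)

/-- The partition with a given antitone sequence of parts vanishing at some index. -/
def ofAntitone (f : ℕ → ℕ) (hf : Antitone f) (N : ℕ) (hN : f N = 0) : Ptn where
  parts := f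
  antitone' := hf
  finite_support' := (Set.finite_Iio N).subset fun i hi => by
    by_contra h
    exact hi (Nat.le_zero.mp (hN ▸ hf (not_lt.mp h)))

/-- The set of indices of parts larger than `j` is an initial segment. -/
theorem lt_ncard_iff (p : Ptn) (i j : ℕ) : i < {k | j < p.parts k}.ncard ↔ j < p.parts i := by
  classical
  obtain ⟨N, hN⟩ := p.exists_parts_eq_zero
  have hex : ∃ k, p.parts k ≤ j := ⟨N, by omega⟩
  have hset : {k | j < p.parts k} = Set.Iio (Nat.find hex) := by
    ext k
    simp only [Set.mem_ofPred_eq, Set.mem_Iio, Nat.lt_find_iff, not_le]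
    exact ⟨fun h m hm => h.trans_le (p.antitone' hm), fun h => h k le_rfl⟩
  have hi : j < p.parts i ↔ i ∈ Set.Iio (Nat.find hex) := by rw [← hset]; rfl
  rw [hi, hset, ← Finset.coe_Iio, Set.ncard_coe_finset, Nat.card_Iio, Finset.coe_Iio, Set.mem_Iio]

theorem lt_length_iff (p : Ptn) (i : ℕ) : i < p.length ↔ p.parts i ≠ 0 := by
  rw [← Nat.pos_iff_ne_zero, ← p.lt_ncard_iff i 0]
  simp only [Nat.pos_iff_ne_zero]
  rfl

/-- The conjugate partition. -/
noncomputable def conj (p : Ptn) : Ptn :=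
  ofAntitone (fun j => {k | j < p.parts k}.ncard)
    (fun j j' h => by
      by_contra! hlt
      rw [p.lt_ncard_iff] at hlt
      exact lt_irrefl _ ((p.lt_ncard_iff _ _).mpr (h.trans_lt hlt)))
    (p.parts 0) (by
      by_contra hne
      exact lt_irrefl _ ((p.lt_ncard_iff _ _).mp (Nat.pos_of_ne_zero hne)))

theorem lt_conj_parts_iff (p : Ptn) (i j : ℕ) : i < p.conj.parts j ↔ j < p.parts i :=
  p.lt_ncard_iff i j

theorem conj_conj (p : Ptn) : p.conj.conj = p := by
  ext i
  refine eq_of_forall_lt_iff fun j => ?_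
  rw [lt_conj_parts_iff, lt_conj_parts_iff]

theorem conj_parts_zero (p : Ptn) : p.conj.parts 0 = p.length :=
  eq_of_forall_lt_iff fun i => by
    rw [lt_conj_parts_iff, lt_length_iff, Nat.pos_iff_ne_zero]

theorem conj_parts_eq_zero_iff (p : Ptn) (n : ℕ) :
    p.conj.parts n = 0 ↔ ∀ i, p.parts i ≤ n := by
  rw [← not_iff_not, ← ne_eq, ← Nat.pos_iff_ne_zero, lt_conj_parts_iff]
  push Not
  exact ⟨fun h => ⟨0, h⟩, fun ⟨i, hi⟩ => hi.trans_le (p.antitone' (Nat.zero_le i))⟩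

theorem size_eq_sum_range (p : Ptn) {N : ℕ} (hN : p.parts N = 0) :
    p.size = ∑ i ∈ Finset.range N, p.parts i := by
  refine finsum_eq_sum_of_support_subset _ fun i hi => ?_
  by_contra h
  exact hi (p.parts_eq_zero_of_le (by simpa using h) hN)

theorem size_conj (p : Ptn) : p.conj.size = p.size := by
  obtain ⟨N, hN⟩ := p.exists_parts_eq_zero
  obtain ⟨M, hM⟩ := p.conj.exists_parts_eq_zero
  have hcount : ∀ (q : Ptn) (i K : ℕ), q.parts i ≤ K →
      q.parts i = ((Finset.range K).filter fun j => j < q.parts i).card := fun q i K h => by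
    rw [show (Finset.range K).filter (fun j => j < q.parts i) = Finset.range (q.parts i) by
      ext j; simp only [Finset.mem_filter, Finset.mem_range]; omega, Finset.card_range]
  have hpM : ∀ i, p.parts i ≤ M := (p.conj_parts_eq_zero_iff M).mp hM
  have hcN : ∀ j, p.conj.parts j ≤ N :=
    (p.conj.conj_parts_eq_zero_iff N).mp (by rwa [conj_conj])
  rw [p.size_eq_sum_range hN, p.conj.size_eq_sum_range hM,
    Finset.sum_congr rfl fun j _ => hcount p.conj j N (hcN j),
    Finset.sum_congr rfl fun i _ => hcount p i M (hpM i)]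
  simp only [lt_conj_parts_iff, Finset.card_filter]
  exact Finset.sum_comm

/-- The parts of the distinct partition with at most `4 n` parts built from the conjugates
`μ 0, …, μ 3` of four partitions with parts at most `n`. -/
def interleave (n : ℕ) (μ₀ μ₁ μ₂ μ₃ : ℕ → ℕ) (i : ℕ) : ℕ :=
  (4 * n - 1 - i) + (μ₀ ((i + 3) / 4) + μ₁ ((i + 2) / 4) + μ₂ ((i + 1) / 4) + μ₃ (i / 4))

section interleave

variable (n : ℕ) (μ₀ μ₁ μ₂ μ₃ : ℕ → ℕ)

theorem interleave_four_mul (k : ℕ) :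
    interleave n μ₀ μ₁ μ₂ μ₃ (4 * k) = (4 * n - 1 - 4 * k) + (μ₀ k + μ₁ k + μ₂ k + μ₃ k) := by
  simp only [interleave, show (4 * k + 3) / 4 = k by omega, show (4 * k + 2) / 4 = k by omega,
    show (4 * k + 1) / 4 = k by omega, show 4 * k / 4 = k by omega]

theorem interleave_four_mul_add_one (k : ℕ) :
    interleave n μ₀ μ₁ μ₂ μ₃ (4 * k + 1) =
      (4 * n - 1 - (4 * k + 1)) + (μ₀ (k + 1) + μ₁ k + μ₂ k + μ₃ k) := by
  simp only [interleave, show (4 * k + 1 + 3) / 4 = k + 1 by omega,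
    show (4 * k + 1 + 2) / 4 = k by omega,
    show (4 * k + 1 + 1) / 4 = k by omega, show (4 * k + 1) / 4 = k by omega]

theorem interleave_four_mul_add_two (k : ℕ) :
    interleave n μ₀ μ₁ μ₂ μ₃ (4 * k + 2) =
      (4 * n - 1 - (4 * k + 2)) + (μ₀ (k + 1) + μ₁ (k + 1) + μ₂ k + μ₃ k) := by
  simp only [interleave, show (4 * k + 2 + 3) / 4 = k + 1 by omega,
    show (4 * k + 2 + 2) / 4 = k + 1 by omega,
    show (4 * k + 2 + 1) / 4 = k by omega, show (4 * k + 2) / 4 = k by omega]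

theorem interleave_four_mul_add_three (k : ℕ) :
    interleave n μ₀ μ₁ μ₂ μ₃ (4 * k + 3) =
      (4 * n - 1 - (4 * k + 3)) + (μ₀ (k + 1) + μ₁ (k + 1) + μ₂ (k + 1) + μ₃ k) := by
  simp only [interleave, show (4 * k + 3 + 3) / 4 = k + 1 by omega,
    show (4 * k + 3 + 2) / 4 = k + 1 by omega,
    show (4 * k + 3 + 1) / 4 = k + 1 by omega, show (4 * k + 3) / 4 = k by omega]

variable {n μ₀ μ₁ μ₂ μ₃}

theorem antitone_interleave (h₀ : Antitone μ₀) (h₁ : Antitone μ₁) (h₂ : Antitone μ₂)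
    (h₃ : Antitone μ₃) : Antitone (interleave n μ₀ μ₁ μ₂ μ₃) := fun i j hij => by
  have := h₀ (show (i + 3) / 4 ≤ (j + 3) / 4 by omega)
  have := h₁ (show (i + 2) / 4 ≤ (j + 2) / 4 by omega)
  have := h₂ (show (i + 1) / 4 ≤ (j + 1) / 4 by omega)
  have := h₃ (show i / 4 ≤ j / 4 by omega)
  simp only [interleave]
  omega

/-- The sequences `μ` are recovered from their interleaving by downward induction. -/
theorem interleave_injective {ν₀ ν₁ ν₂ ν₃ : ℕ → ℕ}
    (hn : ∀ k, n ≤ k → μ₀ k = ν₀ k ∧ μ₁ k = ν₁ k ∧ μ₂ k = ν₂ k ∧ μ₃ k = ν₃ k)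
    (h : ∀ i, interleave n μ₀ μ₁ μ₂ μ₃ i = interleave n ν₀ ν₁ ν₂ ν₃ i) (k : ℕ) :
    μ₀ k = ν₀ k ∧ μ₁ k = ν₁ k ∧ μ₂ k = ν₂ k ∧ μ₃ k = ν₃ k := by
  rcases le_total n k with hk | hk
  · exact hn k hk
  induction hk using Nat.decreasingInduction with
  | self => exact hn n le_rfl
  | of_succ k hk ih =>
    have e₀ := h (4 * k)
    have e₁ := h (4 * k + 1)
    have e₂ := h (4 * k + 2)
    have e₃ := h (4 * k + 3)
    simp only [interleave_four_mul, interleave_four_mul_add_one, interleave_four_mul_add_two,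
      interleave_four_mul_add_three] at e₀ e₁ e₂ e₃
    omega

/-- A sequence with gaps at least one before index `4 n` is the interleaving of its partial
sums of gaps. -/
theorem eq_interleave {f d : ℕ → ℕ} (hzero : ∀ i, 4 * n ≤ i → f i = 0)
    (hd : ∀ i, i < 4 * n → f i + (4 * n - 1 - (i + 1)) = f (i + 1) + (4 * n - 1 - i) + d i)
    (i : ℕ) :
    f i = interleave n (fun k => ∑ j ∈ Finset.Ico k n, d (4 * j))
      (fun k => ∑ j ∈ Finset.Ico k n, d (4 * j + 1))
      (fun k => ∑ j ∈ Finset.Ico k n, d (4 * j + 2))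
      (fun k => ∑ j ∈ Finset.Ico k n, d (4 * j + 3)) i := by
  rcases le_total (4 * n) i with hi | hi
  · simp only [interleave, hzero i hi]
    rw [Finset.Ico_eq_empty (by omega), Finset.Ico_eq_empty (by omega),
      Finset.Ico_eq_empty (by omega), Finset.Ico_eq_empty (by omega)]
    simp only [Finset.sum_empty]
    omega
  induction hi using Nat.decreasingInduction with
  | self =>
    rw [hzero _ le_rfl, interleave_four_mul]
    simp only [Finset.Ico_self, Finset.sum_empty]
    omega
  | of_succ i hi ih =>
    have hdi := hd i hi
    obtain ⟨k, s, hs, rfl⟩ : ∃ k s, s < 4 ∧ i = 4 * k + s := ⟨i / 4, i % 4, by omega, by omega⟩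
    have hk : k < n := by omega
    interval_cases s
    · rw [show 4 * k + 0 + 1 = 4 * k + 1 by omega] at *
      rw [interleave_four_mul_add_one] at ih
      rw [Nat.add_zero] at *
      rw [interleave_four_mul]
      have := Finset.sum_eq_sum_Ico_succ_bot hk fun j => d (4 * j)
      omega
    · rw [show 4 * k + 1 + 1 = 4 * k + 2 by omega] at *
      rw [interleave_four_mul_add_two] at ih
      rw [interleave_four_mul_add_one]
      have := Finset.sum_eq_sum_Ico_succ_bot hk fun j => d (4 * j + 1)
      omega
    · rw [show 4 * k + 2 + 1 = 4 * k + 3 by omega] at *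
      rw [interleave_four_mul_add_three] at ih
      rw [interleave_four_mul_add_two]
      have := Finset.sum_eq_sum_Ico_succ_bot hk fun j => d (4 * j + 2)
      omega
    · rw [show 4 * k + 3 + 1 = 4 * (k + 1) by omega] at *
      rw [interleave_four_mul] at ih
      rw [interleave_four_mul_add_three]
      have := Finset.sum_eq_sum_Ico_succ_bot hk fun j => d (4 * j + 3)
      omega

theorem sum_range_interleave (n : ℕ) (μ₀ μ₁ μ₂ μ₃ : ℕ → ℕ) :
    ∑ k ∈ Finset.range n, interleave n μ₀ μ₁ μ₂ μ₃ (4 * k) =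
      n * (2 * n + 1) + (∑ k ∈ Finset.range n, μ₀ k + ∑ k ∈ Finset.range n, μ₁ k +
        ∑ k ∈ Finset.range n, μ₂ k + ∑ k ∈ Finset.range n, μ₃ k) := by
  have hstair : ∑ k ∈ Finset.range n, (4 * n - 1 - 4 * k) = n * (2 * n + 1) := by
    rw [← Finset.sum_range_reflect]
    calc ∑ j ∈ Finset.range n, (4 * n - 1 - 4 * (n - 1 - j))
        = ∑ j ∈ Finset.range n, (4 * j + 3) := Finset.sum_congr rfl fun j hj => by
          have := Finset.mem_range.mp hj
          omega
      _ = n * (2 * n + 1) := by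
          clear μ₀ μ₁ μ₂ μ₃
          induction n with
          | zero => rfl
          | succ n ih => rw [Finset.sum_range_succ, ih]; ring
  simp only [interleave_four_mul, Finset.sum_add_distrib, hstair]

end interleave

/-- The partition whose parts interleave the conjugates of a quadruple of partitions. -/
noncomputable def ofQuad (n : ℕ) (q : Ptn × Ptn × Ptn × Ptn) : Ptn :=
  ofAntitone
    (interleave n q.1.conj.parts q.2.1.conj.parts q.2.2.1.conj.parts q.2.2.2.conj.parts)
    (antitone_interleave q.1.conj.antitone' q.2.1.conj.antitone' q.2.2.1.conj.antitone'
      q.2.2.2.conj.antitone')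
    (4 * (n + q.1.parts 0 + q.2.1.parts 0 + q.2.2.1.parts 0 + q.2.2.2.parts 0)) (by
      have h : ∀ (p : Ptn) {k : ℕ}, p.parts 0 ≤ k → p.conj.parts k = 0 := fun p k hk =>
        (p.conj_parts_eq_zero_iff k).mpr fun i => (p.antitone' (Nat.zero_le i)).trans hk
      rw [interleave_four_mul, h q.1 (by omega), h q.2.1 (by omega), h q.2.2.1 (by omega),
        h q.2.2.2 (by omega)]
      omega)

theorem ofQuad_parts (n : ℕ) (q : Ptn × Ptn × Ptn × Ptn) (i : ℕ) : (ofQuad n q).parts i =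
    interleave n q.1.conj.parts q.2.1.conj.parts q.2.2.1.conj.parts q.2.2.2.conj.parts i :=
  rfl

theorem Distinct.parts_add_le {p : Ptn} (hp : p.Distinct) (i : ℕ) (hi : p.parts i ≠ 0) :
    p.parts i + i ≤ p.parts 0 := by
  induction i with
  | zero => simp
  | succ i ih =>
    have := hp i hi
    have := ih (by omega)
    omega

theorem finite_setOf_distinct_parts_zero_eq (a : ℕ) :
    {p : Ptn | p.Distinct ∧ p.parts 0 = a}.Finite := by
  refine Set.Finite.of_finite_image
    (f := fun p : Ptn => fun i : Fin (a + 1) => p.parts i) ?_ ?_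
  · refine (Set.Finite.pi' fun _ : Fin (a + 1) => Set.finite_Iic a).subset ?_
    rintro _ ⟨p, ⟨-, rfl⟩, rfl⟩ i
    exact p.antitone' (Nat.zero_le _)
  · rintro p ⟨hp, hpa⟩ q ⟨hq, hqa⟩ h
    ext i
    rcases lt_or_ge i (a + 1) with hi | hi
    · exact congrFun h ⟨i, hi⟩
    · have h₁ : p.parts i = 0 := by
        by_contra hne
        have := hp.parts_add_le i hne
        omega
      have h₂ : q.parts i = 0 := by
        by_contra hne
        have := hq.parts_add_le i hne
        omega
      rw [h₁, h₂]

theorem finsum_parts_four_mul (p : Ptn) {n : ℕ} (hn : p.parts (4 * n) = 0) :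
    ∑ᶠ k : ℕ, p.parts (4 * k) = ∑ k ∈ Finset.range n, p.parts (4 * k) := by
  refine finsum_eq_sum_of_support_subset _ fun k hk => ?_
  by_contra h
  have hnk : n ≤ k := by simpa using h
  exact hk (p.parts_eq_zero_of_le (by omega) hn)

theorem ofQuad_parts_eq_zero {n : ℕ} {q : Ptn × Ptn × Ptn × Ptn}
    (h₀ : ∀ i, q.1.parts i ≤ n) (h₁ : ∀ i, q.2.1.parts i ≤ n)
    (h₂ : ∀ i, q.2.2.1.parts i ≤ n) (h₃ : ∀ i, q.2.2.2.parts i ≤ n) :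
    (ofQuad n q).parts (4 * n) = 0 := by
  rw [← conj_parts_eq_zero_iff] at h₀ h₁ h₂ h₃
  rw [ofQuad_parts, interleave_four_mul]
  omega

theorem ofQuad_distinct {n : ℕ} {q : Ptn × Ptn × Ptn × Ptn}
    (h : (ofQuad n q).parts (4 * n) = 0) : (ofQuad n q).Distinct := fun i hi => by
  have hin : i + 1 < 4 * n := by
    by_contra hge
    exact hi ((ofQuad n q).parts_eq_zero_of_le (not_lt.mp hge) h)
  have := q.1.conj.antitone' (show (i + 3) / 4 ≤ (i + 1 + 3) / 4 by omega)
  have := q.2.1.conj.antitone' (show (i + 2) / 4 ≤ (i + 1 + 2) / 4 by omega)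
  have := q.2.2.1.conj.antitone' (show (i + 1) / 4 ≤ (i + 1 + 1) / 4 by omega)
  have := q.2.2.2.conj.antitone' (show i / 4 ≤ (i + 1) / 4 by omega)
  simp only [ofQuad_parts, interleave]
  omega

theorem ofQuad_length {n : ℕ} {q : Ptn × Ptn × Ptn × Ptn}
    (h : (ofQuad n q).parts (4 * n) = 0) :
    4 * n - 1 ≤ (ofQuad n q).length ∧ (ofQuad n q).length ≤ 4 * n := by
  constructor
  · by_contra! hlt
    have hz : (ofQuad n q).parts (ofQuad n q).length = 0 :=
      not_not.mp (((ofQuad n q).lt_length_iff _).not.mp (lt_irrefl _))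
    rw [ofQuad_parts, interleave] at hz
    omega
  · exact not_lt.mp fun hlt => ((ofQuad n q).lt_length_iff _).mp hlt h

theorem ofQuad_injOn (n : ℕ) : Set.InjOn (ofQuad n)
    {q | (∀ i, q.1.parts i ≤ n) ∧ (∀ i, q.2.1.parts i ≤ n) ∧
      (∀ i, q.2.2.1.parts i ≤ n) ∧ (∀ i, q.2.2.2.parts i ≤ n)} := by
  rintro ⟨q₀, q₁, q₂, q₃⟩ ⟨h₀, h₁, h₂, h₃⟩ ⟨r₀, r₁, r₂, r₃⟩ ⟨g₀, g₁, g₂, g₃⟩ h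
  rw [← conj_parts_eq_zero_iff] at h₀ h₁ h₂ h₃ g₀ g₁ g₂ g₃
  have key := interleave_injective (n := n)
    (fun k hk => ⟨(parts_eq_zero_of_le _ hk h₀).trans (parts_eq_zero_of_le _ hk g₀).symm,
      (parts_eq_zero_of_le _ hk h₁).trans (parts_eq_zero_of_le _ hk g₁).symm,
      (parts_eq_zero_of_le _ hk h₂).trans (parts_eq_zero_of_le _ hk g₂).symm,
      (parts_eq_zero_of_le _ hk h₃).trans (parts_eq_zero_of_le _ hk g₃).symm⟩)
    fun i => congrArg (fun p => p.parts i) h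
  have conj_inj : ∀ {p r : Ptn}, (∀ k, p.conj.parts k = r.conj.parts k) → p = r :=
    fun {p r} h => by rw [← p.conj_conj, ← r.conj_conj, Ptn.ext h]
  exact Prod.ext (conj_inj fun k => (key k).1) <| Prod.ext (conj_inj fun k => (key k).2.1) <|
    Prod.ext (conj_inj fun k => (key k).2.2.1) (conj_inj fun k => (key k).2.2.2)

theorem exists_ofQuad_eq {p : Ptn} {n : ℕ} (hp : p.Distinct) (hlow : 4 * n - 1 ≤ p.length)
    (hup : p.length ≤ 4 * n) :
    ∃ q, ((∀ i, q.1.parts i ≤ n) ∧ (∀ i, q.2.1.parts i ≤ n) ∧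
      (∀ i, q.2.2.1.parts i ≤ n) ∧ (∀ i, q.2.2.2.parts i ≤ n)) ∧ ofQuad n q = p := by
  let d : ℕ → ℕ := fun i => p.parts i + (4 * n - 1 - (i + 1)) - (p.parts (i + 1) + (4 * n - 1 - i))
  have hzero : ∀ i, 4 * n ≤ i → p.parts i = 0 := fun i hi =>
    not_not.mp ((p.lt_length_iff i).not.mp (by omega))
  have hd : ∀ i, i < 4 * n →
      p.parts i + (4 * n - 1 - (i + 1)) = p.parts (i + 1) + (4 * n - 1 - i) + d i := fun i hi => by
    have hle : p.parts (i + 1) + (4 * n - 1 - i) ≤ p.parts i + (4 * n - 1 - (i + 1)) := by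
      by_cases hz : p.parts (i + 1) = 0
      · have := (p.lt_length_iff i)
        omega
      · have := hp i hz
        omega
    exact (Nat.add_sub_cancel' hle).symm
  let μ : ℕ → Ptn := fun r => ofAntitone (fun k => ∑ j ∈ Finset.Ico k n, d (4 * j + r))
    (fun k l hkl => Finset.sum_le_sum_of_subset (Finset.Ico_subset_Ico_left hkl)) n (by simp)
  have hμ : ∀ r i, (μ r).conj.parts i ≤ n := fun r => by
    rw [← conj_parts_eq_zero_iff, conj_conj]
    simp [μ, ofAntitone]
  refine ⟨((μ 0).conj, (μ 1).conj, (μ 2).conj, (μ 3).conj), ⟨hμ 0, hμ 1, hμ 2, hμ 3⟩, ?_⟩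
  ext i
  rw [ofQuad_parts]
  simp only [conj_conj]
  exact (eq_interleave hzero hd i).symm

theorem ofQuad_parts_zero {n : ℕ} (q : Ptn × Ptn × Ptn × Ptn) :
    (ofQuad n q).parts 0 =
      (4 * n - 1) + (q.1.length + q.2.1.length + q.2.2.1.length + q.2.2.2.length) := by
  simpa only [ofQuad_parts, conj_parts_zero, mul_zero, Nat.sub_zero] using
    interleave_four_mul n q.1.conj.parts q.2.1.conj.parts q.2.2.1.conj.parts q.2.2.2.conj.parts 0

theorem finsum_ofQuad_parts {n : ℕ} {q : Ptn × Ptn × Ptn × Ptn}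
    (h₀ : ∀ i, q.1.parts i ≤ n) (h₁ : ∀ i, q.2.1.parts i ≤ n)
    (h₂ : ∀ i, q.2.2.1.parts i ≤ n) (h₃ : ∀ i, q.2.2.2.parts i ≤ n) :
    ∑ᶠ k : ℕ, (ofQuad n q).parts (4 * k) =
      n * (2 * n + 1) + (q.1.size + q.2.1.size + q.2.2.1.size + q.2.2.2.size) := by
  rw [finsum_parts_four_mul _ (ofQuad_parts_eq_zero h₀ h₁ h₂ h₃)]
  rw [← conj_parts_eq_zero_iff] at h₀ h₁ h₂ h₃
  simp only [ofQuad_parts, sum_range_interleave]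
  rw [← size_eq_sum_range _ h₀, ← size_eq_sum_range _ h₁, ← size_eq_sum_range _ h₂,
    ← size_eq_sum_range _ h₃, size_conj, size_conj, size_conj, size_conj]

end Ptn

open Ptn in
theorem T_eq_ncard_distinct {n : ℕ} (hn : 0 < n) (a b : ℕ) :
    T n a b = {p : Ptn | p.Distinct ∧ (4 * n - 1 ≤ p.length ∧ p.length ≤ 4 * n) ∧
      p.parts 0 = a ∧ (∑ᶠ k : ℕ, p.parts (4 * k)) = b}.ncard := by
  refine Set.ncard_congr (fun q _ => ofQuad n q) ?_ ?_ ?_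
  · rintro q ⟨h₀, h₁, h₂, h₃, hl, hs⟩
    have hz := ofQuad_parts_eq_zero h₀ h₁ h₂ h₃
    refine ⟨ofQuad_distinct hz, ofQuad_length hz, ?_, ?_⟩
    · rw [ofQuad_parts_zero]
      omega
    · rw [finsum_ofQuad_parts h₀ h₁ h₂ h₃]
      zify
      linarith
  · rintro q r ⟨h₀, h₁, h₂, h₃, -⟩ ⟨g₀, g₁, g₂, g₃, -⟩ h
    exact ofQuad_injOn n ⟨h₀, h₁, h₂, h₃⟩ ⟨g₀, g₁, g₂, g₃⟩ h
  · rintro p ⟨hp, ⟨hlow, hup⟩, hpa, hpb⟩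
    obtain ⟨q, ⟨h₀, h₁, h₂, h₃⟩, rfl⟩ := exists_ofQuad_eq hp hlow hup
    refine ⟨q, ⟨h₀, h₁, h₂, h₃, ?_, ?_⟩, rfl⟩
    · rw [ofQuad_parts_zero] at hpa
      omega
    · rw [finsum_ofQuad_parts h₀ h₁ h₂ h₃] at hpb
      rw [← hpb]
      push_cast
      ring

theorem T_eq_zero {n a b : ℕ} (h : a + 1 < 4 * n) : T n a b = 0 := by
  refine (congrArg Set.ncard (Set.eq_empty_of_forall_notMem fun q hq => ?_)).trans
    (Set.ncard_empty _)
  have := hq.2.2.2.2.1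
  omega

theorem Ptn.ncard_distinct_length_eq_zero (a b : ℕ) :
    {p : Ptn | p.Distinct ∧ p.length = 0 ∧ p.parts 0 = a ∧
      (∑ᶠ k : ℕ, p.parts (4 * k)) = b}.ncard = if a = 0 ∧ b = 0 then 1 else 0 := by
  have hparts : ∀ {p : Ptn}, p.length = 0 → ∀ i, p.parts i = 0 := fun {p} h i =>
    not_not.mp ((p.lt_length_iff i).not.mp (by omega))
  split_ifs with h
  · obtain ⟨rfl, rfl⟩ := h
    rw [Set.ncard_eq_one]
    refine ⟨ofAntitone (fun _ => 0) antitone_const 0 rfl, Set.eq_singleton_iff_unique_mem.mpr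
      ⟨⟨fun i hi => (hi rfl).elim, ?_, rfl, finsum_zero⟩, fun p hp => ?_⟩⟩
    · simp [Ptn.length, ofAntitone]
    · ext i
      exact hparts hp.2.1 i
  · refine (congrArg Set.ncard (Set.eq_empty_of_forall_notMem fun p hp => h ?_)).trans
      (Set.ncard_empty _)
    obtain ⟨-, hl, rfl, rfl⟩ := hp
    exact ⟨hparts hl 0, by simp only [hparts hl, finsum_zero]⟩

/-- Coefficient-wise form of
`∑ z^{λ_1} q^{λ_1+λ_5+λ_9+⋯} = 1 + ∑_{n≥1} q^{C(2n+1,2)} z^{4n-1}/(qz;q)_n⁴`,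
summed over distinct-part `λ` with `ℓ(λ) ≡ 0` or `3 (mod 4)`. -/
theorem mork_sum_identity_one (a b : ℕ) :
    {p : Ptn | p.Distinct ∧ (p.length % 4 = 0 ∨ p.length % 4 = 3) ∧
        p.parts 0 = a ∧ (∑ᶠ k : ℕ, p.parts (4 * k)) = b}.ncard
      = (if a = 0 ∧ b = 0 then 1 else 0) + ∑ᶠ n : ℕ, T (n + 1) a b := by
  classical
  have hfin : {p : Ptn | p.Distinct ∧ (p.length % 4 = 0 ∨ p.length % 4 = 3) ∧
      p.parts 0 = a ∧ (∑ᶠ k : ℕ, p.parts (4 * k)) = b}.Finite :=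
    (Ptn.finite_setOf_distinct_parts_zero_eq a).subset fun p hp => ⟨hp.1, hp.2.2.1⟩
  have hlen : ∀ p ∈ hfin.toFinset, (p.length + 1) / 4 ∈ Finset.range (a + 1 + 1) := by
    intro p hp
    obtain ⟨hd, -, hpa, -⟩ := hfin.mem_toFinset.mp hp
    rw [Finset.mem_range]
    by_contra! hge
    have hne := (p.lt_length_iff (a + 1)).mp (by omega)
    have := hd.parts_add_le _ hne
    omega
  have hfiber : ∀ n, (hfin.toFinset.filter fun p => (p.length + 1) / 4 = n).card =
      {p : Ptn | p.Distinct ∧ (4 * n - 1 ≤ p.length ∧ p.length ≤ 4 * n) ∧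
        p.parts 0 = a ∧ (∑ᶠ k : ℕ, p.parts (4 * k)) = b}.ncard := fun n => by
    rw [← Set.ncard_coe_finset]
    congr 1
    ext p
    simp only [Finset.coe_filter, Set.Finite.mem_toFinset, Set.mem_ofPred_eq]
    constructor
    · rintro ⟨⟨hd, hl, h⟩, hn⟩
      exact ⟨hd, by omega, h⟩
    · rintro ⟨hd, hl, h⟩
      exact ⟨⟨hd, by omega, h⟩, by omega⟩
  have hsum : ∑ᶠ n : ℕ, T (n + 1) a b = ∑ n ∈ Finset.range (a + 1), T (n + 1) a b := by
    refine finsum_eq_sum_of_support_subset _ fun n hn => ?_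
    by_contra h
    have hna : a + 1 ≤ n := by simpa using h
    exact hn (T_eq_zero (by omega))
  rw [Set.ncard_eq_toFinset_card _ hfin, Finset.card_eq_sum_card_fiberwise hlen,
    Finset.sum_range_succ', hsum, add_comm]
  congr 1
  · rw [hfiber, ← Ptn.ncard_distinct_length_eq_zero]
    congr 1
    ext p
    simp
  · exact Finset.sum_congr rfl fun n _ => by
      rw [hfiber, T_eq_ncard_distinct n.succ_pos]
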